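/- arXiv:1812.02022 — 3 statements merged into one kernel-verified Lean document; each statement's English description precedes it below -/
import Mathlib

section
/- (Analytic Egorov Lemma, parts (1)–(2).) Let s > 0 and 0 < σ < s. There exists C_σ > 0 depending only on σ such that for every ℏ > 0, every a, G ∈ A_s with G ≠ 0, and every t ∈ ℝ with |t| < σ²/(2‖G‖_s): the series Ψ_t^{G,ℏ} a := Σ_{j=0}^∞ (1/j!)(it/ℏ)^j Ad_G^{♯ℏ,j}(a) converges absolutely in the norm ‖·‖_{s−σ}, its sum belongs to A_{s−σ}, and ‖Ψ_t^{G,ℏ} a − a‖_{s−σ} ≤ C_σ |t| ‖G‖_s ‖a‖_s. -/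
open MeasureTheory Real Filter Topology
open scoped ENNReal BigOperators

noncomputable section

/-- Phase space ℝ^{2d} = (x, ξ). -/
abbrev Pd (d : ℕ) : Type := (Fin d → ℝ) × (Fin d → ℝ)

/-- Euclidean inner product on phase space. -/
def dotP {d : ℕ} (w z : Pd d) : ℝ :=
  (∑ j, w.1 j * z.1 j) + ∑ j, w.2 j * z.2 j

/-- Euclidean norm on phase space. -/
def normP {d : ℕ} (z : Pd d) : ℝ :=
  Real.sqrt ((∑ j, (z.1 j) ^ 2) + ∑ j, (z.2 j) ^ 2)

/-- Fourier transform  â(w) = ∫ e^{-i w·z} a(z) dz. -/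
def fourierT {d : ℕ} (a : Pd d → ℂ) (w : Pd d) : ℂ :=
  ∫ z : Pd d, Complex.exp (-(Complex.I * (dotP w z))) * a z

/-- The analytic norm ‖a‖_s = ∫ |â(w)| e^{s‖w‖} dw  (with values in ℝ≥0∞). -/
def Anorm {d : ℕ} (s : ℝ) (a : Pd d → ℂ) : ℝ≥0∞ :=
  ∫⁻ w : Pd d, ENNReal.ofReal (‖fourierT a w‖ * Real.exp (s * normP w))

/-- Membership in the space A_s : integrable with finite ‖·‖_s norm. -/
def MemAs {d : ℕ} (s : ℝ) (a : Pd d → ℂ) : Prop :=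
  Integrable a ∧ Anorm s a < ⊤

instance fact2pi : Fact (0 < 2 * Real.pi) := ⟨Real.two_pi_pos⟩

/-- The circle ℝ/2πℤ. -/
abbrev Circle2pi : Type := AddCircle (2 * Real.pi)

/-- The torus 𝕋^d = ℝ^d/2πℤ^d. -/
abbrev Torus (d : ℕ) : Type := Fin d → Circle2pi

/-- Cosine on the circle. -/
def aCos : Circle2pi → ℝ := Real.cos_periodic.lift

/-- Sine on the circle. -/
def aSin : Circle2pi → ℝ := Real.sin_periodic.lift

/-- The torus action Φ_τ^H on phase space: rotation by angle τ_j in the (x_j, ξ_j)-plane. -/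
def PhiT {d : ℕ} (τ : Torus d) (z : Pd d) : Pd d :=
  (fun j => aCos (τ j) * z.1 j + aSin (τ j) * z.2 j,
   fun j => -aSin (τ j) * z.1 j + aCos (τ j) * z.2 j)

/-- The one-parameter line t ↦ tω in the torus. -/
def lineTorus {d : ℕ} (ω : Fin d → ℝ) (t : ℝ) : Torus d :=
  fun j => ((t * ω j : ℝ) : Circle2pi)

/-- The harmonic oscillator flow φ_t^H = Φ_{tω}^H. -/
def phiH {d : ℕ} (ω : Fin d → ℝ) (t : ℝ) (z : Pd d) : Pd d :=
  PhiT (lineTorus ω t) z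

/-- G_ω : the closure in 𝕋^d of the orbit {tω}. -/
def Gomega {d : ℕ} (ω : Fin d → ℝ) : Set (Torus d) :=
  closure (Set.range (lineTorus ω))

/-- ν is the normalized Haar measure of the compact subgroup G_ω :
it is a probability measure, carried by G_ω, invariant under translation by
elements of G_ω.  These properties determine it uniquely. -/
def IsHaarOnG {d : ℕ} (ω : Fin d → ℝ) (ν : Measure (Torus d)) : Prop :=
  IsProbabilityMeasure ν ∧ ν (Gomega ω)ᶜ = 0 ∧
    ∀ g ∈ Gomega ω, Measure.map (fun τ => g + τ) ν = ν

/-- The average ⟨a⟩ of a along the harmonic oscillator flow. -/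
def avg {d : ℕ} (ν : Measure (Torus d)) (a : Pd d → ℂ) (z : Pd d) : ℂ :=
  ∫ τ, a (PhiT τ z) ∂ν

/-- The standard symplectic form ς((x,ξ),(y,η)) = ξ·y − x·η. -/
def symp {d : ℕ} (w v : Pd d) : ℝ :=
  (∑ j, w.2 j * v.1 j) - ∑ j, w.1 j * v.2 j

/-- The Moyal product a ♯_ℏ b. -/
def moyal {d : ℕ} (ℏ : ℝ) (a b : Pd d → ℂ) (z : Pd d) : ℂ :=
  (((2 * Real.pi) ^ (4 * d) : ℝ) : ℂ)⁻¹ *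
    ∫ p : Pd d × Pd d,
      fourierT a p.1 * fourierT b (p.2 - p.1) *
        Complex.exp (Complex.I * ℏ / 2 * (symp p.1 (p.2 - p.1) : ℝ)) *
        Complex.exp (Complex.I * (dotP p.2 z : ℝ))

/-- The Moyal commutator [a,b]_ℏ = a ♯_ℏ b − b ♯_ℏ a. -/
def moyalComm {d : ℕ} (ℏ : ℝ) (a b : Pd d → ℂ) : Pd d → ℂ :=
  fun z => moyal ℏ a b z - moyal ℏ b a z

/-- Coordinate vector in the x_j direction. -/
def ex {d : ℕ} (j : Fin d) : Pd d := (Pi.single j 1, 0)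

/-- Coordinate vector in the ξ_j direction. -/
def exi {d : ℕ} (j : Fin d) : Pd d := (0, Pi.single j 1)

/-- Directional derivative of a complex-valued symbol. -/
def pdC {d : ℕ} (v : Pd d) (f : Pd d → ℂ) (z : Pd d) : ℂ := fderiv ℝ f z v

/-- The Poisson bracket {a,b} = Σ_j (∂_{ξ_j}a ∂_{x_j}b − ∂_{x_j}a ∂_{ξ_j}b). -/
def poisson {d : ℕ} (a b : Pd d → ℂ) (z : Pd d) : ℂ :=
  ∑ j, (pdC (exi j) a z * pdC (ex j) b z - pdC (ex j) a z * pdC (exi j) b z)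

/-- Iterated Moyal adjoint Ad_G^{♯ℏ,j}(a). -/
def adM {d : ℕ} (ℏ : ℝ) (G : Pd d → ℂ) : ℕ → (Pd d → ℂ) → (Pd d → ℂ)
  | 0, a => a
  | j + 1, a => moyalComm ℏ G (adM ℏ G j a)

/-- The j-th term of the series defining Ψ_t^{G,ℏ} a. -/
def psiTerm {d : ℕ} (t ℏ : ℝ) (G a : Pd d → ℂ) (j : ℕ) : Pd d → ℂ :=
  fun z => ((Complex.I * t / ℏ) ^ j / (j.factorial : ℂ)) * adM ℏ G j a z

/-- Ψ_t^{G,ℏ} a = Σ_j (1/j!)(it/ℏ)^j Ad_G^{♯ℏ,j}(a). -/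
def Psi {d : ℕ} (t ℏ : ℝ) (G a : Pd d → ℂ) (z : Pd d) : ℂ :=
  ∑' j : ℕ, psiTerm t ℏ G a j z

open scoped FourierTransform in
/-- **Fourier inversion**, almost everywhere version for integrable functions. -/
theorem fourierInv_fourier_ae_eq {V : Type*} [NormedAddCommGroup V] [InnerProductSpace ℝ V]
    [FiniteDimensional ℝ V] [MeasurableSpace V] [BorelSpace V] {f : V → ℂ}
    (hf : Integrable f) (hf' : Integrable (𝓕 f)) : 𝓕⁻ (𝓕 f) =ᵐ[volume] f := by
  have hcont : Continuous (𝓕⁻ (𝓕 f)) := by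
    have : 𝓕⁻ (𝓕 f) = fun v => 𝓕 (𝓕 f) (-v) := by
      ext v
      exact Real.fourierInv_eq_fourier_neg _ _
    rw [this]
    exact (VectorFourier.fourierIntegral_continuous Real.continuous_fourierChar
      (L := innerₗ V) continuous_inner hf').comp continuous_neg
  refine ae_eq_of_integral_contDiff_smul_eq hcont.locallyIntegrable hf.locallyIntegrable ?_
  intro g hg hgc
  have hgc' : HasCompactSupport (fun x => (g x : ℂ)) := hgc.comp_left Complex.ofReal_zero
  let φ : SchwartzMap V ℂ := hgc'.toSchwartzMap (Complex.ofRealCLM.contDiff.comp hg)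
  have hφ : ∀ x, φ x = (g x : ℂ) := fun x => rfl
  let ψ : SchwartzMap V ℂ := 𝓕⁻ φ
  have hψ : 𝓕 ψ = φ := by simp [ψ]
  have h1 : ∫ x, 𝓕 (ψ : V → ℂ) x • f x = ∫ x, ψ x • 𝓕 f x := by
    simpa using! VectorFourier.integral_fourierIntegral_smul_eq_flip (L := innerₗ V)
      Real.continuous_fourierChar continuous_inner (ψ.integrable (μ := volume)) hf
  have h2 : ∫ x, 𝓕⁻ (φ : V → ℂ) x • 𝓕 f x = ∫ x, φ x • 𝓕⁻ (𝓕 f) x := by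
    have hflip : (-innerₗ V).flip = -innerₗ V := by
      ext x y
      simp [real_inner_comm]
    have := VectorFourier.integral_fourierIntegral_smul_eq_flip (L := -innerₗ V)
      Real.continuous_fourierChar (by simpa using! continuous_inner.neg)
      (φ.integrable (μ := volume)) hf'
    rw [hflip] at this
    exact this
  rw [← SchwartzMap.fourier_coe, hψ] at h1
  rw [← SchwartzMap.fourierInv_coe] at h2
  have h3 := h2.symm.trans h1.symm
  simpa [hφ] using h3

/-- The Euclidean model of phase space. -/
abbrev EPd (d : ℕ) : Type := WithLp 2 (EuclideanSpace ℝ (Fin d) × EuclideanSpace ℝ (Fin d))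

/-- Forgetting the Euclidean structure of phase space. -/
def ePd (d : ℕ) : EPd d ≃ᵐ Pd d :=
  (MeasurableEquiv.toLp 2 (EuclideanSpace ℝ (Fin d) × EuclideanSpace ℝ (Fin d))).symm.trans
    (MeasurableEquiv.prodCongr (MeasurableEquiv.toLp 2 (Fin d → ℝ)).symm
      (MeasurableEquiv.toLp 2 (Fin d → ℝ)).symm)

theorem ePd_measurePreserving (d : ℕ) : MeasurePreserving (ePd d) := by
  refine (WithLp.volume_preserving_symm_measurableEquiv_toLp_prod _ _).trans ?_
  exact MeasurePreserving.prod (EuclideanSpace.volume_preserving_symm_measurableEquiv_toLp _)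
    (EuclideanSpace.volume_preserving_symm_measurableEquiv_toLp _)

theorem dotP_ePd {d : ℕ} (x y : EPd d) : dotP (ePd d x) (ePd d y) = inner ℝ x y := by
  rw [WithLp.prod_inner_apply]
  simp only [PiLp.inner_apply, dotP]
  simp [ePd, MeasurableEquiv.prodCongr, mul_comm]

instance isAddHaarMeasure_Pd (d : ℕ) : (volume : Measure (Pd d)).IsAddHaarMeasure :=
  Measure.prod.instIsAddHaarMeasure volume volume

theorem finrank_Pd (d : ℕ) : Module.finrank ℝ (Pd d) = 2 * d := by
  simp; ring

theorem dotP_smul_left {d : ℕ} (c : ℝ) (w z : Pd d) : dotP (c • w) z = c * dotP w z := by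
  simp [dotP, mul_add, Finset.mul_sum, mul_assoc]

/-- The unimodular number `e^{ix}`. -/
def phase (x : ℝ) : ℂ := Complex.exp (Complex.I * x)

/-- The normalization constant of the Fourier transform on phase space. -/
def fourierConst (d : ℕ) : ℂ := (((2 * π) ^ (2 * d) : ℝ) : ℂ)⁻¹

/-- The inverse Fourier transform on phase space. -/
def invFourierT {d : ℕ} (f : Pd d → ℂ) (z : Pd d) : ℂ :=
  fourierConst d * ∫ v : Pd d, f v * phase (dotP v z)

open scoped FourierTransform in
theorem fourierT_eq_fourier {d : ℕ} (a : Pd d → ℂ) (v : EPd d) :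
    𝓕 (a ∘ ePd d) v = fourierT a ((2 * π) • ePd d v) := by
  rw [Real.fourier_eq', fourierT, ← (ePd_measurePreserving d).integral_comp
    (ePd d).measurableEmbedding]
  refine integral_congr_ae (Eventually.of_forall fun x => ?_)
  simp only [Function.comp_apply, smul_eq_mul, dotP_smul_left, dotP_ePd]
  rw [real_inner_comm]
  congr 2
  push_cast
  ring

open scoped FourierTransform in
theorem ae_eq_invFourierT {d : ℕ} {a : Pd d → ℂ} (ha : Integrable a)
    (ha' : Integrable (fourierT a)) : invFourierT (fourierT a) =ᵐ[volume] a := by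
  have hmp := ePd_measurePreserving d
  have h2π : (2 * π : ℝ) ≠ 0 := by positivity
  have hF : 𝓕 (a ∘ ePd d) = (fun w => fourierT a ((2 * π) • w)) ∘ ePd d := by
    ext v
    exact fourierT_eq_fourier a v
  have hi : Integrable (a ∘ ePd d) :=
    (hmp.integrable_comp_emb (ePd d).measurableEmbedding).2 ha
  have hi' : Integrable (𝓕 (a ∘ ePd d)) := by
    rw [hF]
    exact (hmp.integrable_comp_emb (ePd d).measurableEmbedding).2 (ha'.comp_smul h2π)
  have key := fourierInv_fourier_ae_eq hi hi'
  have hinv : 𝓕⁻ (𝓕 (a ∘ ePd d)) = invFourierT (fourierT a) ∘ ePd d := by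
    ext x
    rw [hF, Real.fourierInv_eq', Function.comp_apply, invFourierT, fourierConst]
    have h1 := Measure.integral_comp_smul (volume : Measure (Pd d))
      (fun v => fourierT a v * phase (dotP v (ePd d x))) (2 * π)
    rw [finrank_Pd] at h1
    rw [abs_of_pos (by positivity)] at h1
    rw [show (((2 * π) ^ (2 * d) : ℝ) : ℂ)⁻¹ = ((((2 * π) ^ (2 * d))⁻¹ : ℝ) : ℂ) by push_cast; rfl,
      ← Complex.real_smul, ← h1, ← hmp.integral_comp (ePd d).measurableEmbedding]
    refine integral_congr_ae (Eventually.of_forall fun v => ?_)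
    simp only [Function.comp_apply, smul_eq_mul, dotP_smul_left, dotP_ePd]
    rw [mul_comm, phase]
    congr 2
    push_cast
    ring
  rw [hinv] at key
  have := hmp.symm.quasiMeasurePreserving.ae key
  filter_upwards [this] with z hz
  simpa using hz

theorem phase_add (x y : ℝ) : phase (x + y) = phase x * phase y := by
  rw [phase, phase, phase, ← Complex.exp_add]
  push_cast
  ring_nf

theorem norm_phase (x : ℝ) : ‖phase x‖ = 1 := by
  rw [phase, mul_comm, Complex.norm_exp_ofReal_mul_I]

theorem enorm_phase (x : ℝ) : ‖phase x‖ₑ = 1 := by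
  rw [← ofReal_norm, norm_phase, ENNReal.ofReal_one]

@[fun_prop]
theorem continuous_phase : Continuous phase := by
  unfold phase
  fun_prop

@[fun_prop]
theorem continuous_dotP {d : ℕ} {X : Type*} [TopologicalSpace X] {f g : X → Pd d}
    (hf : Continuous f) (hg : Continuous g) : Continuous fun x => dotP (f x) (g x) := by
  unfold dotP
  fun_prop

@[fun_prop]
theorem continuous_symp {d : ℕ} {X : Type*} [TopologicalSpace X] {f g : X → Pd d}
    (hf : Continuous f) (hg : Continuous g) : Continuous fun x => symp (f x) (g x) := by
  unfold symp
  fun_prop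

@[fun_prop]
theorem continuous_normP {d : ℕ} : Continuous (normP : Pd d → ℝ) := by
  unfold normP
  fun_prop

theorem dotP_add_left {d : ℕ} (w v z : Pd d) : dotP (w + v) z = dotP w z + dotP v z := by
  simp only [dotP, Prod.fst_add, Prod.snd_add, Pi.add_apply, add_mul, Finset.sum_add_distrib]
  ring

theorem dotP_add_right {d : ℕ} (w v z : Pd d) : dotP w (v + z) = dotP w v + dotP w z := by
  simp only [dotP, Prod.fst_add, Prod.snd_add, Pi.add_apply, mul_add, Finset.sum_add_distrib]
  ring

theorem dotP_neg_left {d : ℕ} (w z : Pd d) : dotP (-w) z = -dotP w z := by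
  simp only [dotP, Prod.fst_neg, Prod.snd_neg, Pi.neg_apply, neg_mul, Finset.sum_neg_distrib]
  ring

theorem dotP_smul_right {d : ℕ} (c : ℝ) (w z : Pd d) : dotP w (c • z) = c * dotP w z := by
  simp [dotP, mul_add, Finset.mul_sum, mul_left_comm]

/-- The complex structure on phase space dual to the symplectic form. -/
def rotJ {d : ℕ} (w : Pd d) : Pd d := (w.2, -w.1)

@[fun_prop]
theorem continuous_rotJ {d : ℕ} : Continuous (rotJ : Pd d → Pd d) := by
  unfold rotJ
  fun_prop

theorem dotP_rotJ {d : ℕ} (v w : Pd d) : dotP v (rotJ w) = symp w v := by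
  simp only [dotP, rotJ, symp, Pi.neg_apply, mul_neg, Finset.sum_neg_distrib, sub_eq_add_neg]
  simp only [mul_comm]

theorem symp_swap {d : ℕ} (w v : Pd d) : symp v w = -symp w v := by
  simp only [symp, mul_comm]
  ring

theorem fourierT_eq_phase {d : ℕ} (a : Pd d → ℂ) (w : Pd d) :
    fourierT a w = ∫ z : Pd d, phase (-dotP w z) * a z := by
  simp [fourierT, phase]

theorem MeasureTheory.Integrable.phase_mul {X : Type*} [MeasurableSpace X] [TopologicalSpace X]
    [OpensMeasurableSpace X] {μ : Measure X} {f : X → ℂ} (hf : Integrable f μ)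
    {g : X → ℝ} (hg : Continuous g) : Integrable (fun x => phase (g x) * f x) μ :=
  hf.bdd_mul (c := 1) ((continuous_phase.comp hg).measurable.aestronglyMeasurable)
    (Eventually.of_forall fun _ => (norm_phase _).le)

theorem continuous_fourierT {d : ℕ} {a : Pd d → ℂ} (ha : Integrable a) :
    Continuous (fourierT a) := by
  have : fourierT a = fun w => ∫ z : Pd d, phase (-dotP w z) * a z :=
    funext (fourierT_eq_phase a)
  rw [this]
  refine continuous_of_dominated (bound := fun z => ‖a z‖)
    (fun w => (ha.phase_mul (by fun_prop)).aestronglyMeasurable)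
    (fun w => Eventually.of_forall fun z => ?_) ha.norm
    (Eventually.of_forall fun z => by fun_prop)
  rw [norm_mul, norm_phase, one_mul]

theorem norm_fourierT_le {d : ℕ} (a : Pd d → ℂ) (w : Pd d) :
    ‖fourierT a w‖ ≤ ∫ z, ‖a z‖ := by
  rw [fourierT_eq_phase]
  refine (norm_integral_le_integral_norm _).trans_eq ?_
  simp [norm_phase]

theorem fourierT_congr_ae {d : ℕ} {a b : Pd d → ℂ} (h : a =ᵐ[volume] b) :
    fourierT a = fourierT b := by
  ext w
  refine integral_congr_ae ?_
  filter_upwards [h] with z hz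
  rw [hz]

theorem fourierT_sub {d : ℕ} {a b : Pd d → ℂ} (ha : Integrable a) (hb : Integrable b)
    (w : Pd d) : fourierT (fun z => a z - b z) w = fourierT a w - fourierT b w := by
  simp only [fourierT_eq_phase, mul_sub]
  exact integral_sub (ha.phase_mul (by fun_prop)) (hb.phase_mul (by fun_prop))

theorem fourierT_const_mul {d : ℕ} (c : ℂ) (a : Pd d → ℂ) (w : Pd d) :
    fourierT (fun z => c * a z) w = c * fourierT a w := by
  simp only [fourierT, mul_left_comm _ c]
  exact integral_const_mul _ _

theorem phase_symp {d : ℕ} (ℏ : ℝ) (w v : Pd d) :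
    Complex.exp (Complex.I * ℏ / 2 * (symp w v : ℝ)) = phase (ℏ / 2 * symp w v) := by
  rw [phase]
  push_cast
  ring_nf

theorem enorm_fourierConst_le (d : ℕ) : ‖fourierConst d‖ₑ ≤ 1 := by
  rw [← ofReal_norm, ENNReal.ofReal_le_one, fourierConst, norm_inv, Complex.norm_real,
    Real.norm_of_nonneg (by positivity)]
  refine inv_le_one_of_one_le₀ (one_le_pow₀ ?_)
  linarith [Real.pi_gt_three]

/-- The Moyal product as a superposition of modulated phase-space translates. -/
theorem moyal_eq {d : ℕ} (ℏ : ℝ) {a b : Pd d → ℂ} (ha : Integrable (fourierT a))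
    (hb : Integrable (fourierT b)) (z : Pd d) :
    moyal ℏ a b z = fourierConst d * ∫ w, phase (dotP w z) *
      (fourierT a w * invFourierT (fourierT b) (z + (ℏ / 2) • rotJ w)) := by
  have hmp : MeasurePreserving (MeasurableEquiv.shearAddRight (Pd d))
      ((volume : Measure (Pd d)).prod volume) (volume.prod volume) :=
    measurePreserving_prod_add volume volume
  have hint : Integrable (fun q : Pd d × Pd d =>
      phase (ℏ / 2 * symp q.1 q.2 + dotP (q.1 + q.2) z) * (fourierT a q.1 * fourierT b q.2))
      ((volume : Measure (Pd d)).prod volume) :=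
    (ha.mul_prod hb).phase_mul (by fun_prop)
  rw [moyal, Measure.volume_eq_prod,
    ← hmp.integral_comp (MeasurableEquiv.shearAddRight (Pd d)).measurableEmbedding]
  have hcongr : ∀ q : Pd d × Pd d,
      (fun p : Pd d × Pd d => fourierT a p.1 * fourierT b (p.2 - p.1) *
        Complex.exp (Complex.I * ℏ / 2 * (symp p.1 (p.2 - p.1) : ℝ)) *
        Complex.exp (Complex.I * (dotP p.2 z : ℝ))) (MeasurableEquiv.shearAddRight (Pd d) q)
      = phase (ℏ / 2 * symp q.1 q.2 + dotP (q.1 + q.2) z) *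
        (fourierT a q.1 * fourierT b q.2) := by
    intro q
    have : MeasurableEquiv.shearAddRight (Pd d) q = (q.1, q.1 + q.2) := rfl
    simp only [this, add_sub_cancel_left, phase_symp, phase_add]
    rw [← phase]
    ring
  rw [integral_congr_ae (Eventually.of_forall hcongr), integral_prod _ hint]
  have hconst : (((2 * π) ^ (4 * d) : ℝ) : ℂ)⁻¹ = fourierConst d * fourierConst d := by
    rw [fourierConst, ← mul_inv, ← Complex.ofReal_mul, ← pow_add]
    congr 3
    ring
  rw [hconst, mul_assoc, ← integral_const_mul]
  congr 1
  refine integral_congr_ae (Eventually.of_forall fun w => ?_)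
  simp only [invFourierT]
  rw [mul_left_comm (fourierT a w), mul_left_comm (phase _), ← integral_const_mul (fourierT a w),
    ← integral_const_mul (phase _)]
  congr 1
  refine integral_congr_ae (Eventually.of_forall fun v => ?_)
  simp only [dotP_add_right, dotP_smul_right, dotP_rotJ, dotP_add_left, phase_add]
  ring

instance isNegInvariant_Pd (d : ℕ) : (volume : Measure (Pd d)).IsNegInvariant :=
  ⟨((Measure.measurePreserving_neg (volume : Measure (Fin d → ℝ))).prod
    (Measure.measurePreserving_neg (volume : Measure (Fin d → ℝ)))).map_eq⟩

theorem measurePreserving_shear {d : ℕ} {h : Pd d → Pd d} (hh : Continuous h) :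
    MeasurePreserving (fun q : Pd d × Pd d => (q.1, q.2 + h q.1))
      ((volume : Measure (Pd d)).prod volume) (volume.prod volume) :=
  (MeasurePreserving.id volume).skew_product (g := fun w z => z + h w)
    (by simp only [Function.uncurry_def]; fun_prop)
    (Eventually.of_forall fun w => map_add_right_eq_self volume (h w))

theorem lintegral_enorm_mul_shear {d : ℕ} {h : Pd d → Pd d} (hh : Continuous h)
    {f g : Pd d → ℂ} (hf : AEStronglyMeasurable f) (hg : AEStronglyMeasurable g) :
    ∫⁻ z, ∫⁻ w, ‖f w‖ₑ * ‖g (z + h w)‖ₑ = (∫⁻ w, ‖f w‖ₑ) * ∫⁻ z, ‖g z‖ₑ := by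
  rw [lintegral_lintegral_swap]
  · have : ∀ w, ∫⁻ z, ‖f w‖ₑ * ‖g (z + h w)‖ₑ = ‖f w‖ₑ * ∫⁻ z, ‖g z‖ₑ := by
      intro w
      rw [lintegral_const_mul' _ _ enorm_ne_top,
        lintegral_add_right_eq_self (fun z => ‖g z‖ₑ) (h w)]
    simp_rw [this]
    rw [lintegral_mul_const'' _ hf.enorm]
  · have h1 : AEMeasurable (fun q : Pd d × Pd d => ‖f q.1‖ₑ * ‖g q.2‖ₑ)
        ((volume : Measure (Pd d)).prod volume) :=
      (hf.comp_fst.enorm).mul (hg.comp_snd.enorm)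
    have h2 := (h1.comp_quasiMeasurePreserving
      (measurePreserving_shear hh).quasiMeasurePreserving)
    exact (h2.comp_quasiMeasurePreserving Measure.measurePreserving_swap.quasiMeasurePreserving)

theorem integrable_moyal_kernel {d : ℕ} {h : Pd d → Pd d} (hh : Continuous h)
    {f g : Pd d → ℂ} (hf : Integrable f) (hg : Integrable g) :
    Integrable (fun q : Pd d × Pd d => phase (dotP q.1 q.2) * (f q.1 * g (q.2 + h q.1)))
      ((volume : Measure (Pd d)).prod volume) :=
  ((measurePreserving_shear hh).integrable_comp_of_integrable (hf.mul_prod hg)).phase_mul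
    (by fun_prop)

theorem integrable_moyal {d : ℕ} (ℏ : ℝ) {a b : Pd d → ℂ}
    (ha : Integrable (fourierT a)) (hb : Integrable b) (hb' : Integrable (fourierT b)) :
    Integrable (moyal ℏ a b) := by
  rw [funext (moyal_eq ℏ ha hb')]
  exact (integrable_moyal_kernel (h := fun w => (ℏ / 2) • rotJ w) (by fun_prop) ha
    (hb.congr (ae_eq_invFourierT hb hb').symm)).integral_prod_right.const_mul _

theorem lintegral_enorm_moyal_le {d : ℕ} (ℏ : ℝ) {a b : Pd d → ℂ}
    (ha : Integrable (fourierT a)) (hb : Integrable b) (hb' : Integrable (fourierT b)) :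
    ∫⁻ z, ‖moyal ℏ a b z‖ₑ ≤ (∫⁻ w, ‖fourierT a w‖ₑ) * ∫⁻ z, ‖b z‖ₑ := by
  have hae := ae_eq_invFourierT hb hb'
  have h1 := lintegral_enorm_mul_shear (h := fun w => (ℏ / 2) • rotJ w) (by fun_prop)
    ha.aestronglyMeasurable (hb.congr hae.symm).aestronglyMeasurable
  have h2 : ∫⁻ z, ‖invFourierT (fourierT b) z‖ₑ = ∫⁻ z, ‖b z‖ₑ := by
    refine lintegral_congr_ae ?_
    filter_upwards [hae] with z hz
    rw [hz]
  rw [← h2, ← h1]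
  refine lintegral_mono fun z => ?_
  rw [moyal_eq ℏ ha hb', enorm_mul]
  refine (mul_le_of_le_one_left' (enorm_fourierConst_le d)).trans ?_
  refine (enorm_integral_le_lintegral_enorm _).trans_eq ?_
  simp only [enorm_mul, enorm_phase, one_mul]

theorem fourierT_moyal {d : ℕ} (ℏ : ℝ) {a b : Pd d → ℂ}
    (ha : Integrable (fourierT a)) (hb : Integrable b) (hb' : Integrable (fourierT b))
    (p : Pd d) :
    fourierT (moyal ℏ a b) p = fourierConst d * ∫ w, phase (ℏ / 2 * symp w (p - w)) *
      (fourierT a w * fourierT b (p - w)) := by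
  have hae := ae_eq_invFourierT hb hb'
  have hker := integrable_moyal_kernel (h := fun w => (ℏ / 2) • rotJ w) (by fun_prop) ha
    (hb.congr hae.symm)
  rw [funext (moyal_eq ℏ ha hb'), fourierT_const_mul, fourierT_eq_phase]
  congr 1
  simp_rw [← integral_const_mul]
  rw [integral_integral_swap]
  · refine integral_congr_ae (Eventually.of_forall fun w => ?_)
    simp only
    have h1 : ∀ z, phase (-dotP p z) * (phase (dotP w z) *
        (fourierT a w * invFourierT (fourierT b) (z + (ℏ / 2) • rotJ w))) =
        (fun y => fourierT a w * (phase (ℏ / 2 * symp w (p - w)) *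
          (phase (-dotP (p - w) y) * invFourierT (fourierT b) y))) (z + (ℏ / 2) • rotJ w) := by
      intro z
      have h2 : phase (-dotP p z) * phase (dotP w z) = phase (ℏ / 2 * symp w (p - w)) *
          phase (-dotP (p - w) (z + (ℏ / 2) • rotJ w)) := by
        rw [← phase_add, ← phase_add]
        congr 1
        rw [dotP_add_right, dotP_smul_right, dotP_rotJ, sub_eq_add_neg p w, dotP_add_left,
          dotP_neg_left]
        ring
      simp only
      linear_combination (fourierT a w * invFourierT (fourierT b) (z + (ℏ / 2) • rotJ w)) * h2
    rw [integral_congr_ae (Eventually.of_forall h1), integral_add_right_eq_self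
        (fun y => fourierT a w * (phase (ℏ / 2 * symp w (p - w)) *
          (phase (-dotP (p - w) y) * invFourierT (fourierT b) y))) ((ℏ / 2) • rotJ w),
      integral_const_mul, integral_const_mul, ← fourierT_eq_phase, fourierT_congr_ae hae]
    ring
  · have := (hker.phase_mul (g := fun q : Pd d × Pd d => -dotP p q.2) (by fun_prop)).swap
    exact this

theorem fourierT_moyal_swap {d : ℕ} (ℏ : ℝ) {a b : Pd d → ℂ}
    (ha : Integrable (fourierT a)) (hb : Integrable b) (hb' : Integrable (fourierT b))
    (p : Pd d) :
    fourierT (moyal ℏ a b) p = fourierConst d * ∫ w, phase (-(ℏ / 2 * symp w (p - w))) *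
      (fourierT b w * fourierT a (p - w)) := by
  rw [fourierT_moyal ℏ ha hb hb', ← integral_sub_left_eq_self _ volume p]
  congr 1
  refine integral_congr_ae (Eventually.of_forall fun w => ?_)
  simp only [sub_sub_cancel]
  rw [symp_swap w (p - w), mul_neg, mul_comm (fourierT a _)]

theorem integrable_mul_fourierT_sub {d : ℕ} {f b : Pd d → ℂ} (hf : Integrable f)
    (hb : Integrable b) (p : Pd d) : Integrable fun w => f w * fourierT b (p - w) :=
  hf.mul_bdd (c := ∫ z, ‖b z‖)
    ((continuous_fourierT hb).comp (continuous_const.sub continuous_id)).aestronglyMeasurable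
    (Eventually.of_forall fun _ => norm_fourierT_le _ _)

theorem integrable_moyalComm {d : ℕ} (ℏ : ℝ) {a b : Pd d → ℂ}
    (ha : Integrable a) (ha' : Integrable (fourierT a))
    (hb : Integrable b) (hb' : Integrable (fourierT b)) :
    Integrable (moyalComm ℏ a b) :=
  (integrable_moyal ℏ ha' hb hb').sub (integrable_moyal ℏ hb' ha ha')

theorem enorm_fourierT_moyalComm_le {d : ℕ} (ℏ : ℝ) {a b : Pd d → ℂ}
    (ha : Integrable a) (ha' : Integrable (fourierT a))
    (hb : Integrable b) (hb' : Integrable (fourierT b)) (p : Pd d) :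
    ‖fourierT (moyalComm ℏ a b) p‖ₑ ≤ ∫⁻ w,
      ‖phase (ℏ / 2 * symp w (p - w)) - phase (-(ℏ / 2 * symp w (p - w)))‖ₑ *
        (‖fourierT a w‖ₑ * ‖fourierT b (p - w)‖ₑ) := by
  have hi := integrable_mul_fourierT_sub ha' hb p
  rw [show moyalComm ℏ a b = fun z => moyal ℏ a b z - moyal ℏ b a z from rfl,
    fourierT_sub (integrable_moyal ℏ ha' hb hb') (integrable_moyal ℏ hb' ha ha'),
    fourierT_moyal ℏ ha' hb hb', fourierT_moyal_swap ℏ hb' ha ha', ← mul_sub,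
    ← integral_sub (hi.phase_mul (by fun_prop)) (hi.phase_mul (by fun_prop)), enorm_mul]
  refine (mul_le_of_le_one_left' (enorm_fourierConst_le d)).trans ?_
  refine (enorm_integral_le_lintegral_enorm _).trans_eq ?_
  simp only [← sub_mul, enorm_mul]

theorem lintegral_conv {d : ℕ} {f g : Pd d → ℝ≥0∞} (hf : Measurable f) (hg : Measurable g) :
    ∫⁻ p, ∫⁻ w, f w * g (p - w) = (∫⁻ w, f w) * ∫⁻ v, g v := by
  rw [lintegral_lintegral_swap (by simp only [Function.uncurry_def]; fun_prop)]
  have : ∀ w, ∫⁻ p, f w * g (p - w) = f w * ∫⁻ v, g v := fun w => by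
    rw [lintegral_const_mul _ (by fun_prop), lintegral_sub_right_eq_self (fun v => g v) w]
  simp_rw [this]
  exact lintegral_mul_const _ hf

theorem dotP_self {d : ℕ} (z : Pd d) : dotP z z = normP z ^ 2 := by
  rw [normP, Real.sq_sqrt (by positivity)]
  simp only [dotP, sq]

theorem normP_nonneg {d : ℕ} (z : Pd d) : 0 ≤ normP z := Real.sqrt_nonneg _

theorem normP_ePd {d : ℕ} (x : EPd d) : normP (ePd d x) = ‖x‖ := by
  rw [← sq_eq_sq₀ (normP_nonneg _) (norm_nonneg _), ← dotP_self, dotP_ePd,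
    real_inner_self_eq_norm_sq]

theorem normP_add_le {d : ℕ} (w v : Pd d) : normP (w + v) ≤ normP w + normP v := by
  obtain ⟨x, rfl⟩ := (ePd d).surjective w
  obtain ⟨y, rfl⟩ := (ePd d).surjective v
  rw [show ePd d x + ePd d y = ePd d (x + y) from rfl]
  simp only [normP_ePd]
  exact norm_add_le x y

theorem abs_dotP_le {d : ℕ} (w v : Pd d) : |dotP w v| ≤ normP w * normP v := by
  obtain ⟨x, rfl⟩ := (ePd d).surjective w
  obtain ⟨y, rfl⟩ := (ePd d).surjective v
  rw [dotP_ePd, normP_ePd, normP_ePd]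
  exact abs_real_inner_le_norm x y

theorem normP_rotJ {d : ℕ} (w : Pd d) : normP (rotJ w) = normP w := by
  simp [normP, rotJ, add_comm]

theorem abs_symp_le {d : ℕ} (w v : Pd d) : |symp w v| ≤ normP w * normP v := by
  rw [← dotP_rotJ, mul_comm, ← normP_rotJ w]
  exact abs_dotP_le v (rotJ w)

theorem norm_phase_sub_phase_neg_le (x : ℝ) : ‖phase x - phase (-x)‖ ≤ 2 * |x| := by
  have h : phase x - phase (-x) = phase (-x) * (phase (2 * x) - 1) := by
    rw [mul_sub, ← phase_add]
    ring_nf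
  rw [h, norm_mul, norm_phase, one_mul, phase]
  refine Real.norm_exp_I_mul_ofReal_sub_one_le.trans_eq ?_
  rw [norm_mul, Real.norm_ofNat, Real.norm_eq_abs]

theorem enorm_phase_sub_phase_le (x y : ℝ) : ‖phase x - phase y‖ₑ ≤ 2 := by
  refine (enorm_sub_le).trans_eq ?_
  rw [enorm_phase, enorm_phase, one_add_one_eq_two]

theorem le_exp_mul {δ : ℝ} (hδ : 0 < δ) (x : ℝ) : x ≤ exp (-1) / δ * exp (δ * x) := by
  rw [div_mul_eq_mul_div, le_div_iff₀ hδ, ← Real.exp_add]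
  linarith [Real.add_one_le_exp (-1 + δ * x)]

theorem Anorm_eq {d : ℕ} (s : ℝ) (a : Pd d → ℂ) :
    Anorm s a = ∫⁻ w, ‖fourierT a w‖ₑ * ENNReal.ofReal (exp (s * normP w)) := by
  simp only [Anorm, ENNReal.ofReal_mul (norm_nonneg _), ofReal_norm]

theorem Anorm_mono {d : ℕ} {s s' : ℝ} (h : s ≤ s') (a : Pd d → ℂ) : Anorm s a ≤ Anorm s' a := by
  refine lintegral_mono fun w => ENNReal.ofReal_le_ofReal ?_
  have := normP_nonneg w
  gcongr

theorem lintegral_enorm_fourierT_le {d : ℕ} {s : ℝ} (hs : 0 ≤ s) (a : Pd d → ℂ) :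
    ∫⁻ w, ‖fourierT a w‖ₑ ≤ Anorm s a := by
  refine le_trans (le_of_eq ?_) (Anorm_mono hs a)
  simp [Anorm_eq]

theorem MemAs.integrable_fourierT {d : ℕ} {s : ℝ} (hs : 0 ≤ s) {a : Pd d → ℂ} (ha : MemAs s a) :
    Integrable (fourierT a) :=
  ⟨(continuous_fourierT ha.1).aestronglyMeasurable,
    (lintegral_enorm_fourierT_le hs a).trans_lt ha.2⟩

theorem Anorm_const_mul {d : ℕ} (s : ℝ) (c : ℂ) (a : Pd d → ℂ) :
    Anorm s (fun z => c * a z) = ‖c‖ₑ * Anorm s a := by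
  simp only [Anorm_eq, fourierT_const_mul, enorm_mul, mul_assoc]
  exact lintegral_const_mul' _ _ enorm_ne_top

theorem enorm_phase_mul_exp_le {d : ℕ} {ℏ r δ₁ δ₂ : ℝ} (hℏ : 0 < ℏ) (hr : 0 ≤ r)
    (hδ₁ : 0 < δ₁) (hδ₂ : 0 < δ₂) (w p : Pd d) :
    ‖phase (ℏ / 2 * symp w (p - w)) - phase (-(ℏ / 2 * symp w (p - w)))‖ₑ *
        ENNReal.ofReal (exp (r * normP p)) ≤
      ENNReal.ofReal (ℏ * (exp (-1) / δ₁) * (exp (-1) / δ₂)) *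
        (ENNReal.ofReal (exp ((r + δ₁) * normP w)) *
          ENNReal.ofReal (exp ((r + δ₂) * normP (p - w)))) := by
  have hw := normP_nonneg w
  have hv := normP_nonneg (p - w)
  have hp : normP p ≤ normP w + normP (p - w) := by
    simpa using normP_add_le w (p - w)
  rw [← ofReal_norm, ← ENNReal.ofReal_mul (norm_nonneg _), ← ENNReal.ofReal_mul (exp_pos _).le,
    ← ENNReal.ofReal_mul (by positivity)]
  refine ENNReal.ofReal_le_ofReal ?_
  calc _ ≤ (2 * |ℏ / 2 * symp w (p - w)|) * exp (r * (normP w + normP (p - w))) := by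
        gcongr
        exact norm_phase_sub_phase_neg_le _
    _ = ℏ * |symp w (p - w)| * exp (r * (normP w + normP (p - w))) := by
        rw [abs_mul, abs_of_pos (by positivity : 0 < ℏ / 2)]
        ring
    _ ≤ ℏ * ((exp (-1) / δ₁ * exp (δ₁ * normP w)) *
          (exp (-1) / δ₂ * exp (δ₂ * normP (p - w)))) *
          exp (r * (normP w + normP (p - w))) := by
        gcongr
        refine (abs_symp_le _ _).trans ?_
        gcongr
        · exact le_exp_mul hδ₁ _
        · exact le_exp_mul hδ₂ _
    _ = _ := by
        rw [mul_add r, add_mul, add_mul, Real.exp_add, Real.exp_add, Real.exp_add]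
        ring

theorem Anorm_moyalComm_le {d : ℕ} {ℏ r δ₁ δ₂ : ℝ} (hℏ : 0 < ℏ) (hr : 0 ≤ r)
    (hδ₁ : 0 < δ₁) (hδ₂ : 0 < δ₂) {a b : Pd d → ℂ}
    (ha : Integrable a) (ha' : Integrable (fourierT a))
    (hb : Integrable b) (hb' : Integrable (fourierT b)) :
    Anorm r (moyalComm ℏ a b) ≤ ENNReal.ofReal (ℏ * (exp (-1) / δ₁) * (exp (-1) / δ₂)) *
      (Anorm (r + δ₁) a * Anorm (r + δ₂) b) := by
  have hma := (continuous_fourierT ha).measurable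
  have hmb := (continuous_fourierT hb).measurable
  simp only [Anorm_eq]
  rw [← lintegral_conv (by fun_prop) (by fun_prop), ← lintegral_const_mul' _ _ ENNReal.ofReal_ne_top]
  refine lintegral_mono fun p => ?_
  simp only
  rw [← lintegral_const_mul' _ _ ENNReal.ofReal_ne_top]
  refine (mul_le_mul_left (enorm_fourierT_moyalComm_le ℏ ha ha' hb hb' p) _).trans ?_
  rw [← lintegral_mul_const' _ _ ENNReal.ofReal_ne_top]
  refine lintegral_mono fun w => ?_
  calc _ = (‖phase (ℏ / 2 * symp w (p - w)) - phase (-(ℏ / 2 * symp w (p - w)))‖ₑ *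
        ENNReal.ofReal (exp (r * normP p))) * (‖fourierT a w‖ₑ * ‖fourierT b (p - w)‖ₑ) := by
        ring
    _ ≤ _ := mul_le_mul_left (enorm_phase_mul_exp_le hℏ hr hδ₁ hδ₂ w p) _
    _ = _ := by ring

theorem lintegral_enorm_fourierT_moyalComm_le {d : ℕ} (ℏ : ℝ) {a b : Pd d → ℂ}
    (ha : Integrable a) (ha' : Integrable (fourierT a))
    (hb : Integrable b) (hb' : Integrable (fourierT b)) :
    ∫⁻ p, ‖fourierT (moyalComm ℏ a b) p‖ₑ ≤
      2 * ((∫⁻ w, ‖fourierT a w‖ₑ) * ∫⁻ w, ‖fourierT b w‖ₑ) := by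
  have hma := (continuous_fourierT ha).measurable
  have hmb := (continuous_fourierT hb).measurable
  rw [← lintegral_conv (by fun_prop) (by fun_prop), ← lintegral_const_mul' _ _ (by simp)]
  refine lintegral_mono fun p => ?_
  rw [← lintegral_const_mul' _ _ (by simp)]
  refine (enorm_fourierT_moyalComm_le ℏ ha ha' hb hb' p).trans ?_
  exact lintegral_mono fun w => mul_le_mul_left (enorm_phase_sub_phase_le _ _) _

/-- The sum of the `L¹` norms of a symbol and of its Fourier transform. -/
def wienerNorm {d : ℕ} (a : Pd d → ℂ) : ℝ≥0∞ := (∫⁻ z, ‖a z‖ₑ) + ∫⁻ w, ‖fourierT a w‖ₑ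

theorem wienerNorm_moyalComm_le {d : ℕ} (ℏ : ℝ) {a b : Pd d → ℂ}
    (ha : Integrable a) (ha' : Integrable (fourierT a))
    (hb : Integrable b) (hb' : Integrable (fourierT b)) :
    wienerNorm (moyalComm ℏ a b) ≤ 2 * wienerNorm a * wienerNorm b := by
  have h1 : ∫⁻ z, ‖moyalComm ℏ a b z‖ₑ ≤ (∫⁻ w, ‖fourierT a w‖ₑ) * (∫⁻ z, ‖b z‖ₑ) +
      (∫⁻ w, ‖fourierT b w‖ₑ) * ∫⁻ z, ‖a z‖ₑ := by
    calc _ ≤ ∫⁻ z, (‖moyal ℏ a b z‖ₑ + ‖moyal ℏ b a z‖ₑ) := lintegral_mono fun z => enorm_sub_le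
      _ = (∫⁻ z, ‖moyal ℏ a b z‖ₑ) + ∫⁻ z, ‖moyal ℏ b a z‖ₑ :=
        lintegral_add_left' (integrable_moyal ℏ ha' hb hb').aestronglyMeasurable.enorm _
      _ ≤ _ := add_le_add (lintegral_enorm_moyal_le ℏ ha' hb hb')
        (lintegral_enorm_moyal_le ℏ hb' ha ha')
  refine (add_le_add h1 (lintegral_enorm_fourierT_moyalComm_le ℏ ha ha' hb hb')).trans ?_
  rw [wienerNorm, wienerNorm]
  generalize ∫⁻ w, ‖fourierT a w‖ₑ = A'
  generalize ∫⁻ w, ‖fourierT b w‖ₑ = B'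
  generalize ∫⁻ w, ‖a w‖ₑ = A
  generalize ∫⁻ w, ‖b w‖ₑ = B
  calc _ ≤ (A' * B + B' * A + 2 * (A' * B')) + (2 * (A * B) + A' * B + B' * A) := le_self_add
    _ = _ := by ring

theorem adM_spec {d : ℕ} (ℏ : ℝ) {G a : Pd d → ℂ}
    (hG : Integrable G) (hG' : Integrable (fourierT G))
    (ha : Integrable a) (ha' : Integrable (fourierT a)) (j : ℕ) :
    Integrable (adM ℏ G j a) ∧ Integrable (fourierT (adM ℏ G j a)) ∧
      wienerNorm (adM ℏ G j a) ≤ (2 * wienerNorm G) ^ j * wienerNorm a := by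
  induction j with
  | zero => exact ⟨ha, ha', by simp [adM]⟩
  | succ j ih =>
    obtain ⟨h1, h2, h3⟩ := ih
    refine ⟨integrable_moyalComm ℏ hG hG' h1 h2, ⟨(continuous_fourierT
      (integrable_moyalComm ℏ hG hG' h1 h2)).aestronglyMeasurable, ?_⟩, ?_⟩
    · refine (lintegral_enorm_fourierT_moyalComm_le ℏ hG hG' h1 h2).trans_lt ?_
      exact ENNReal.mul_lt_top (by simp) (ENNReal.mul_lt_top hG'.2 h2.2)
    · refine (wienerNorm_moyalComm_le ℏ hG hG' h1 h2).trans ?_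
      rw [pow_succ', mul_assoc ((2 : ℝ≥0∞) * wienerNorm G)]
      gcongr

theorem Anorm_adM_le_of_le {d : ℕ} {s σ ℏ : ℝ} (hσ : 0 < σ) (hs : σ < s) (hℏ : 0 < ℏ)
    {G a : Pd d → ℂ} (hG : MemAs s G) (ha : MemAs s a) {n : ℕ} (hn : 0 < n) {k : ℕ}
    (hk : k ≤ n) :
    Anorm (s - k * (σ / n)) (adM ℏ G k a) ≤
      ENNReal.ofReal ((ℏ * (exp (-1) / (σ / n)) ^ 2) ^ k / k.factorial) *
        (Anorm s G ^ k * Anorm s a) := by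
  have hn' : (0 : ℝ) < n := by exact_mod_cast hn
  have hs0 : 0 ≤ s := by linarith
  induction k with
  | zero => simp [adM]
  | succ k ih =>
    have hk' : ((k : ℝ) + 1) ≤ n := by exact_mod_cast hk
    have hpos : 0 < σ / n := by positivity
    have hle : ((k : ℝ) + 1) * (σ / n) ≤ σ := by
      calc _ ≤ n * (σ / n) := by gcongr
        _ = σ := by field_simp
    obtain ⟨h1, h2, -⟩ := adM_spec ℏ hG.1 (hG.integrable_fourierT hs0) ha.1
      (ha.integrable_fourierT hs0) k
    have key := Anorm_moyalComm_le (r := s - (k + 1) * (σ / n)) (δ₁ := (k + 1) * (σ / n))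
      (δ₂ := σ / n) hℏ (by linarith) (by positivity) hpos hG.1 (hG.integrable_fourierT hs0) h1 h2
    rw [sub_add_cancel, show s - (k + 1) * (σ / n) + σ / n = s - k * (σ / n) by ring] at key
    have hcast : ((k + 1 : ℕ) : ℝ) = k + 1 := by push_cast; ring
    rw [hcast]
    refine key.trans ?_
    calc _ ≤ ENNReal.ofReal (ℏ * (exp (-1) / ((k + 1) * (σ / n))) * (exp (-1) / (σ / n))) *
          (Anorm s G * (ENNReal.ofReal ((ℏ * (exp (-1) / (σ / n)) ^ 2) ^ k / k.factorial) *
        (Anorm s G ^ k * Anorm s a))) := by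
          gcongr
          exact ih (by omega)
      _ = (ENNReal.ofReal (ℏ * (exp (-1) / ((k + 1) * (σ / n))) * (exp (-1) / (σ / n))) *
          ENNReal.ofReal ((ℏ * (exp (-1) / (σ / n)) ^ 2) ^ k / k.factorial)) *
          (Anorm s G ^ (k + 1) * Anorm s a) := by ring
      _ = _ := by
          rw [← ENNReal.ofReal_mul (by positivity)]
          congr 2
          rw [Nat.factorial_succ, pow_succ (ℏ * (exp (-1) / (σ / n)) ^ 2)]
          push_cast
          field_simp

theorem Anorm_adM_le {d : ℕ} {s σ ℏ : ℝ} (hσ : 0 < σ) (hs : σ < s) (hℏ : 0 < ℏ)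
    {G a : Pd d → ℂ} (hG : MemAs s G) (ha : MemAs s a) (j : ℕ) :
    Anorm (s - σ) (adM ℏ G j a) ≤
      ENNReal.ofReal ((ℏ / σ ^ 2) ^ j * j.factorial) * (Anorm s G ^ j * Anorm s a) := by
  rcases Nat.eq_zero_or_pos j with rfl | hj
  · simpa [adM] using Anorm_mono (by linarith) a
  have hj' : (0 : ℝ) < j := by exact_mod_cast hj
  have h := Anorm_adM_le_of_le hσ hs hℏ hG ha hj le_rfl
  rw [mul_div_cancel₀ _ hj'.ne'] at h
  refine h.trans ?_
  gcongr
  have h1 : (j : ℝ) ^ j / j.factorial ≤ exp j :=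
    Real.pow_div_factorial_le_exp _ hj'.le _
  have h2 : (j : ℝ) ^ j ≤ exp j * j.factorial := by
    rwa [div_le_iff₀ (by positivity)] at h1
  have h3 : (exp (-1)) ^ j * exp j = 1 := by
    rw [← Real.exp_nat_mul, ← Real.exp_add]
    simp
  have h4 : (exp (-1)) ^ j * (j : ℝ) ^ j ≤ j.factorial := by
    calc _ ≤ (exp (-1)) ^ j * (exp j * j.factorial) := by gcongr
      _ = _ := by rw [← mul_assoc, h3, one_mul]
  rw [div_le_iff₀ (by positivity)]
  calc (ℏ * (exp (-1) / (σ / j)) ^ 2) ^ j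
      = (ℏ / σ ^ 2) ^ j * ((exp (-1)) ^ j * (j : ℝ) ^ j) ^ 2 := by
        rw [← mul_pow, ← pow_mul, mul_comm j 2, pow_mul, ← mul_pow]
        congr 1
        field_simp
    _ ≤ (ℏ / σ ^ 2) ^ j * (j.factorial : ℝ) ^ 2 := by gcongr
    _ = _ := by ring

theorem ae_summable_of_tsum_lintegral_enorm {X : Type*} [MeasurableSpace X] {μ : Measure X}
    {f : ℕ → X → ℂ} (hf : ∀ j, Integrable (f j) μ) (hsum : ∑' j, ∫⁻ x, ‖f j x‖ₑ ∂μ ≠ ⊤) :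
    ∀ᵐ x ∂μ, Summable fun j => f j x := by
  rw [← lintegral_tsum fun j => (hf j).aestronglyMeasurable.enorm] at hsum
  filter_upwards [ae_lt_top' (AEMeasurable.tsum
    fun j => (hf j).aestronglyMeasurable.enorm) hsum] with x hx
  exact (tsum_enorm_ne_top_iff_summable_norm.1 hx.ne).of_norm

theorem integrable_tsum_of_tsum_lintegral_enorm {X : Type*} [MeasurableSpace X] {μ : Measure X}
    {f : ℕ → X → ℂ} (hf : ∀ j, Integrable (f j) μ) (hsum : ∑' j, ∫⁻ x, ‖f j x‖ₑ ∂μ ≠ ⊤) :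
    Integrable (fun x => ∑' j, f j x) μ := by
  constructor
  · refine aestronglyMeasurable_of_tendsto_ae atTop
      (f := fun n x => ∑ j ∈ Finset.range n, f j x)
      (fun n => (integrable_finsetSum _ fun j _ => hf j).aestronglyMeasurable) ?_
    filter_upwards [ae_summable_of_tsum_lintegral_enorm hf hsum] with x hx
    exact hx.hasSum.tendsto_sum_nat
  · refine (lintegral_mono fun x => enorm_tsum_le_tsum_enorm).trans_lt ?_
    rw [lintegral_tsum fun j => (hf j).aestronglyMeasurable.enorm]
    exact hsum.lt_top

theorem Anorm_tsum_le {d : ℕ} (s : ℝ) {f : ℕ → Pd d → ℂ} (hf : ∀ j, Integrable (f j))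
    (hsum : ∑' j, ∫⁻ x, ‖f j x‖ₑ ≠ ⊤) :
    Anorm s (fun z => ∑' j, f j z) ≤ ∑' j, Anorm s (f j) := by
  have hF : ∀ w, fourierT (fun z => ∑' j, f j z) w = ∑' j, fourierT (f j) w := by
    intro w
    simp only [fourierT_eq_phase, ← tsum_mul_left]
    refine integral_tsum (fun j => ((hf j).phase_mul (by fun_prop)).aestronglyMeasurable) ?_
    simpa only [enorm_mul, enorm_phase, one_mul] using hsum
  simp only [Anorm_eq]
  rw [← lintegral_tsum fun j => by
    have := (continuous_fourierT (hf j)).measurable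
    fun_prop]
  refine lintegral_mono fun w => ?_
  simp only
  rw [hF, ENNReal.tsum_mul_right]
  gcongr
  exact enorm_tsum_le_tsum_enorm

theorem enorm_psi_coeff {t ℏ : ℝ} (hℏ : 0 < ℏ) (j : ℕ) :
    ‖(Complex.I * t / ℏ) ^ j / (j.factorial : ℂ)‖ₑ =
      ENNReal.ofReal ((|t| / ℏ) ^ j / j.factorial) := by
  rw [← ofReal_norm]
  congr 1
  simp [abs_of_pos hℏ]

theorem Anorm_psiTerm_le {d : ℕ} {s σ ℏ : ℝ} (hσ : 0 < σ) (hs : σ < s) (hℏ : 0 < ℏ)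
    {G a : Pd d → ℂ} (hG : MemAs s G) (ha : MemAs s a) (t : ℝ) (j : ℕ) :
    Anorm (s - σ) (psiTerm t ℏ G a j) ≤
      (ENNReal.ofReal (|t| / σ ^ 2) * Anorm s G) ^ j * Anorm s a := by
  unfold psiTerm
  rw [Anorm_const_mul, enorm_psi_coeff hℏ]
  refine (mul_le_mul_right (Anorm_adM_le hσ hs hℏ hG ha j) _).trans_eq ?_
  rw [← mul_assoc, ← mul_assoc, ← ENNReal.ofReal_mul (by positivity), mul_pow,
    ← ENNReal.ofReal_pow (by positivity)]
  congr 3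
  rw [div_pow, div_pow, div_pow]
  field_simp

theorem integrable_psiTerm {d : ℕ} (t ℏ : ℝ) {G a : Pd d → ℂ}
    (hG : Integrable G) (hG' : Integrable (fourierT G))
    (ha : Integrable a) (ha' : Integrable (fourierT a)) (j : ℕ) :
    Integrable (psiTerm t ℏ G a j) :=
  (adM_spec ℏ hG hG' ha ha' j).1.const_mul _

theorem tsum_lintegral_enorm_psiTerm_ne_top {d : ℕ} (t : ℝ) {ℏ : ℝ} (hℏ : 0 < ℏ)
    {G a : Pd d → ℂ} (hG : Integrable G) (hG' : Integrable (fourierT G))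
    (ha : Integrable a) (ha' : Integrable (fourierT a)) :
    ∑' j, ∫⁻ z, ‖psiTerm t ℏ G a j z‖ₑ ≠ ⊤ := by
  have hN : 2 * wienerNorm G ≠ ⊤ :=
    ENNReal.mul_ne_top (by simp) (ENNReal.add_ne_top.2 ⟨hG.2.ne, hG'.2.ne⟩)
  have hNa : wienerNorm a ≠ ⊤ := ENNReal.add_ne_top.2 ⟨ha.2.ne, ha'.2.ne⟩
  set K := (2 * wienerNorm G).toReal with hK
  have hK0 : 0 ≤ K := ENNReal.toReal_nonneg
  have hle : ∀ j, ∫⁻ z, ‖psiTerm t ℏ G a j z‖ₑ ≤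
      ENNReal.ofReal ((|t| / ℏ * K) ^ j / j.factorial) * wienerNorm a := by
    intro j
    simp only [psiTerm, enorm_mul]
    rw [lintegral_const_mul' _ _ enorm_ne_top, enorm_psi_coeff hℏ]
    refine (mul_le_mul_right (le_self_add.trans (adM_spec ℏ hG hG' ha ha' j).2.2) _).trans_eq ?_
    rw [← ENNReal.ofReal_toReal hN, ← hK, ← mul_assoc, ← ENNReal.ofReal_pow hK0,
      ← ENNReal.ofReal_mul (by positivity)]
    congr 2
    rw [mul_pow]
    ring
  refine ((ENNReal.tsum_le_tsum hle).trans_lt ?_).ne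
  rw [ENNReal.tsum_mul_right, ← ENNReal.ofReal_tsum_of_nonneg (fun j => by positivity)
    (Real.summable_pow_div_factorial _)]
  exact ENNReal.mul_lt_top ENNReal.ofReal_lt_top hNa.lt_top

theorem Psi_sub_ae_eq {d : ℕ} (t : ℝ) {ℏ : ℝ} (hℏ : 0 < ℏ)
    {G a : Pd d → ℂ} (hG : Integrable G) (hG' : Integrable (fourierT G))
    (ha : Integrable a) (ha' : Integrable (fourierT a)) :
    (fun z => Psi t ℏ G a z - a z) =ᵐ[volume] fun z => ∑' j, psiTerm t ℏ G a (j + 1) z := by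
  filter_upwards [ae_summable_of_tsum_lintegral_enorm (integrable_psiTerm t ℏ hG hG' ha ha')
    (tsum_lintegral_enorm_psiTerm_ne_top t hℏ hG hG' ha ha')] with z hz
  rw [Psi, hz.tsum_eq_zero_add]
  simp [psiTerm, adM]

/-- Analytic Egorov Lemma, parts (1)–(2). There is C_σ > 0,
depending only on σ (and d), such that for ℏ > 0, a, G ∈ A_s with ‖G‖_s ≠ 0 and
|t| ‖G‖_s < σ²/2, the series Ψ_t^{G,ℏ} a converges absolutely in ‖·‖_{s−σ}, its sum
belongs to A_{s−σ}, and ‖Ψ_t^{G,ℏ} a − a‖_{s−σ} ≤ C_σ |t| ‖G‖_s ‖a‖_s. -/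
theorem analytic_egorov_one_two {d : ℕ} (σ : ℝ) (hσ : 0 < σ) :
    ∃ C : ℝ, 0 < C ∧
      ∀ s : ℝ, σ < s → ∀ ℏ : ℝ, 0 < ℏ →
        ∀ a G : Pd d → ℂ, MemAs s a → MemAs s G → Anorm s G ≠ 0 →
          ∀ t : ℝ, ENNReal.ofReal |t| * Anorm s G < ENNReal.ofReal (σ ^ 2 / 2) →
            (∑' j : ℕ, Anorm (s - σ) (psiTerm t ℏ G a j)) < ⊤ ∧
            MemAs (s - σ) (Psi t ℏ G a) ∧
            Anorm (s - σ) (fun z => Psi t ℏ G a z - a z) ≤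
              ENNReal.ofReal (C * |t|) * Anorm s G * Anorm s a := by
  refine ⟨2 / σ ^ 2, by positivity, ?_⟩
  intro s hs ℏ hℏ a G ha hG _ t ht
  have hs0 : 0 ≤ s := by linarith
  have hG' := hG.integrable_fourierT hs0
  have ha' := ha.integrable_fourierT hs0
  set r : ℝ≥0∞ := ENNReal.ofReal (|t| / σ ^ 2) * Anorm s G with hr
  have hr2 : r ≤ 2⁻¹ := by
    have h1 : r = ENNReal.ofReal (1 / σ ^ 2) * (ENNReal.ofReal |t| * Anorm s G) := by
      rw [hr, ← mul_assoc, ← ENNReal.ofReal_mul (by positivity)]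
      ring_nf
    rw [h1]
    refine (mul_le_mul_right ht.le _).trans_eq ?_
    rw [← ENNReal.ofReal_mul (by positivity), show 1 / σ ^ 2 * (σ ^ 2 / 2) = 2⁻¹ by field_simp,
      ENNReal.ofReal_inv_of_pos two_pos, ENNReal.ofReal_ofNat]
  have hinv : (1 - r)⁻¹ ≤ 2 := by
    rw [ENNReal.inv_le_iff_inv_le]
    refine le_trans ?_ (tsub_le_tsub_left hr2 1)
    rw [ENNReal.one_sub_inv_two]
  have hle := Anorm_psiTerm_le hσ hs hℏ hG ha t
  have hint := integrable_psiTerm t ℏ hG.1 hG' ha.1 ha'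
  have hsum := tsum_lintegral_enorm_psiTerm_ne_top t hℏ hG.1 hG' ha.1 ha'
  have hfin : ∑' j : ℕ, Anorm (s - σ) (psiTerm t ℏ G a j) < ⊤ := by
    refine (ENNReal.tsum_le_tsum hle).trans_lt ?_
    rw [ENNReal.tsum_mul_right, ENNReal.tsum_geometric]
    exact ENNReal.mul_lt_top (hinv.trans_lt (by simp)) ha.2
  refine ⟨hfin, ⟨integrable_tsum_of_tsum_lintegral_enorm hint hsum,
    (Anorm_tsum_le _ hint hsum).trans_lt hfin⟩, ?_⟩
  have hcongr : Anorm (s - σ) (fun z => Psi t ℏ G a z - a z) =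
      Anorm (s - σ) (fun z => ∑' j, psiTerm t ℏ G a (j + 1) z) := by
    simp only [Anorm, fourierT_congr_ae (Psi_sub_ae_eq t hℏ hG.1 hG' ha.1 ha')]
  have hsum' : ∑' j, ∫⁻ z, ‖psiTerm t ℏ G a (j + 1) z‖ₑ ≠ ⊤ :=
    ne_top_of_le_ne_top hsum (ENNReal.tsum_comp_le_tsum_of_injective
      (add_left_injective 1) fun j => ∫⁻ z, ‖psiTerm t ℏ G a j z‖ₑ)
  rw [hcongr]
  calc _ ≤ ∑' j, Anorm (s - σ) (psiTerm t ℏ G a (j + 1)) :=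
        Anorm_tsum_le _ (fun j => hint (j + 1)) hsum'
    _ ≤ ∑' j, r ^ (j + 1) * Anorm s a := ENNReal.tsum_le_tsum fun j => hle (j + 1)
    _ = r * (1 - r)⁻¹ * Anorm s a := by
        rw [ENNReal.tsum_mul_right, ENNReal.tsum_geometric_add_one]
    _ ≤ r * 2 * Anorm s a := by gcongr
    _ = ENNReal.ofReal (2 / σ ^ 2 * |t|) * Anorm s G * Anorm s a := by
        rw [show 2 / σ ^ 2 * |t| = 2 * (|t| / σ ^ 2) by ring, ENNReal.ofReal_mul zero_le_two,
          ENNReal.ofReal_ofNat, hr]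
        ring

end
end

section
/- (Small-divisor estimate for the Diophantine cohomological equation.) Let d ≥ 1, ω ∈ (0,∞)^d with resonance module Λ_ω = {k ∈ ℤ^d : ω·k = 0}, and suppose ω is partially Diophantine: there exist C > 0 and ν > 0 with |ω·k|^{−1} ≤ C|k|^ν for all k ∈ ℤ^d ∖ Λ_ω. Let ρ, s > 0 and 0 < σ < ρ, and let g be bounded, continuous and integrable on ℝ^{2d} with torus Fourier coefficients g_k, satisfying ‖g‖_{ρ,s} < ∞. Then (2π)^{−d} Σ_{k ∈ ℤ^d ∖ Λ_ω} (‖g_k‖_s / |ω·k|) e^{(ρ−σ)|k|} ≤ C (ν/(eσ))^ν ‖g‖_{ρ,s}. (In particular the formal solution f of the cohomological equation {H,f} = g − ⟨g⟩, with coefficients f_k = g_k/(i ω·k) for k ∉ Λ_ω and f_k = 0 for k ∈ Λ_ω, satisfies ‖f‖_{ρ−σ,s} ≤ C (ν/(eσ))^ν ‖g‖_{ρ,s}.) -/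
open MeasureTheory Real Filter Topology
open scoped ENNReal BigOperators

noncomputable section

/-- e^{iθ} for θ on the circle ℝ/2πℤ. -/
def expC (θ : Circle2pi) : ℂ := (aCos θ : ℂ) + (aSin θ : ℂ) * Complex.I

/-- The k-th torus Fourier coefficient g_k(z) = ∫_{𝕋^d} g(Φ_τ^H(z)) e^{-ik·τ} dτ. -/
def torusCoeff {d : ℕ} (a : Pd d → ℂ) (k : Fin d → ℤ) (z : Pd d) : ℂ :=
  ∫ τ : Torus d, a (PhiT τ z) * expC (-(∑ j, k j • τ j))

/-- ℓ¹ size |k| of a lattice vector k ∈ ℤ^d. -/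
def knorm {d : ℕ} (k : Fin d → ℤ) : ℝ := ∑ j, |(k j : ℝ)|

/-- ω·k. -/
def omegaDot {d : ℕ} (ω : Fin d → ℝ) (k : Fin d → ℤ) : ℝ := ∑ j, (k j : ℝ) * ω j

/-- The weighted norm ‖a‖_{ρ,s} = (2π)^{−d} Σ_k ‖a_k‖_s e^{ρ|k|}. -/
def AnormRS {d : ℕ} (ρ s : ℝ) (a : Pd d → ℂ) : ℝ≥0∞ :=
  (ENNReal.ofReal ((2 * Real.pi) ^ d))⁻¹ *
    ∑' k : Fin d → ℤ, Anorm s (torusCoeff a k) * ENNReal.ofReal (Real.exp (ρ * knorm k))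

theorem rpow_le_mul_exp {ν σ x : ℝ} (hν : 0 < ν) (hσ : 0 < σ) (hx : 0 ≤ x) :
    x ^ ν ≤ (ν / (Real.exp 1 * σ)) ^ ν * Real.exp (σ * x) := by
  have h : x ≤ ν / (Real.exp 1 * σ) * Real.exp (σ * x / ν) := by
    calc x = ν / σ * (σ * x / ν) := by field_simp
      _ ≤ ν / σ * Real.exp (σ * x / ν - 1) := by
        gcongr
        linarith [Real.add_one_le_exp (σ * x / ν - 1)]
      _ = ν / (Real.exp 1 * σ) * Real.exp (σ * x / ν) := by
        rw [Real.exp_sub]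
        field_simp
  calc x ^ ν ≤ (ν / (Real.exp 1 * σ) * Real.exp (σ * x / ν)) ^ ν :=
        Real.rpow_le_rpow hx h hν.le
    _ = (ν / (Real.exp 1 * σ)) ^ ν * Real.exp (σ * x) := by
        rw [Real.mul_rpow (by positivity) (by positivity), ← Real.exp_mul,
          div_mul_cancel₀ _ hν.ne']

theorem knorm_nonneg {d : ℕ} (k : Fin d → ℤ) : 0 ≤ knorm k :=
  Finset.sum_nonneg fun _ _ => abs_nonneg _

/-- small-divisor estimate for the Diophantine cohomological
equation: (2π)^{−d} Σ_{k ∉ Λ_ω} (‖g_k‖_s/|ω·k|) e^{(ρ−σ)|k|} ≤ C (ν/(eσ))^ν ‖g‖_{ρ,s}. -/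
theorem small_divisor_estimate {d : ℕ} (hd : 1 ≤ d) (ω : Fin d → ℝ) (hω : ∀ j, 0 < ω j)
    (C ν : ℝ) (hC : 0 < C) (hν : 0 < ν)
    (hdio : ∀ k : Fin d → ℤ, omegaDot ω k ≠ 0 → |omegaDot ω k|⁻¹ ≤ C * knorm k ^ ν)
    (ρ s σ : ℝ) (hρ : 0 < ρ) (hs : 0 < s) (hσ : 0 < σ) (hσρ : σ < ρ)
    (g : Pd d → ℂ) (hg_cont : Continuous g) (hg_bdd : ∃ M, ∀ z, ‖g z‖ ≤ M)
    (hg_L1 : Integrable g) (hg_ρs : AnormRS ρ s g < ⊤) :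
    (ENNReal.ofReal ((2 * Real.pi) ^ d))⁻¹ *
        ∑' k : Fin d → ℤ,
          (if omegaDot ω k = 0 then 0 else
            Anorm s (torusCoeff g k) *
              ENNReal.ofReal (Real.exp ((ρ - σ) * knorm k) / |omegaDot ω k|)) ≤
      ENNReal.ofReal (C * (ν / (Real.exp 1 * σ)) ^ ν) * AnormRS ρ s g := by
  unfold AnormRS
  rw [mul_left_comm]
  gcongr
  rw [← ENNReal.tsum_mul_left]
  refine ENNReal.tsum_le_tsum fun k => ?_
  split_ifs with hk
  · exact zero_le
  rw [mul_left_comm, ← ENNReal.ofReal_mul (by positivity)]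
  gcongr
  calc Real.exp ((ρ - σ) * knorm k) / |omegaDot ω k|
      ≤ Real.exp ((ρ - σ) * knorm k) * (C * knorm k ^ ν) := by
        rw [div_eq_mul_inv]
        gcongr
        exact hdio k hk
    _ ≤ Real.exp ((ρ - σ) * knorm k) *
          (C * ((ν / (Real.exp 1 * σ)) ^ ν * Real.exp (σ * knorm k))) := by
        gcongr
        exact rpow_le_mul_exp hν hσ (knorm_nonneg k)
    _ = C * (ν / (Real.exp 1 * σ)) ^ ν * Real.exp (ρ * knorm k) := by
        rw [sub_mul, Real.exp_sub]
        field_simp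

end
end

section
/- Let 𝓗 be a complex Hilbert space and let F = F₁ + iF₂ be a bounded operator on 𝓗, where F₁ and F₂ are bounded self-adjoint operators. Then for every t ∈ ℝ, the operator exponential exp(itF) satisfies ‖exp(itF)‖ ≤ e^{|t| ‖F₂‖} in operator norm. -/
open scoped ComplexOrder

/-- If the numerical range of `A` lies in the half-plane `re z ≤ c`, then `‖exp A‖ ≤ e ^ c`. -/
theorem norm_exp_le_of_re_inner_le {H : Type*} [NormedAddCommGroup H]
    [InnerProductSpace ℂ H] [CompleteSpace H] (A : H →L[ℂ] H) (c : ℝ)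
    (hA : ∀ x, (inner ℂ x (A x)).re ≤ c * ‖x‖ ^ 2) :
    ‖NormedSpace.exp A‖ ≤ Real.exp c := by
  refine ContinuousLinearMap.opNorm_le_bound _ (Real.exp_pos c).le fun x ↦ ?_
  set u : ℝ → H := fun s ↦ NormedSpace.exp (s • A) x with hu_def
  have hu (s : ℝ) : HasDerivAt u (A (u s)) s :=
    ((ContinuousLinearMap.apply ℂ H x).restrictScalars ℝ).hasFDerivAt.comp_hasDerivAt s
      (hasDerivAt_exp_smul_const' (𝕂 := ℝ) A s)
  have hn (s : ℝ) : HasDerivAt (fun s ↦ ‖u s‖ ^ 2) (2 * (inner ℂ (u s) (A (u s))).re) s := by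
    have h := Complex.reCLM.hasFDerivAt.comp_hasDerivAt s ((hu s).inner ℂ (hu s))
    have hval : Complex.reCLM (inner ℂ (u s) (A (u s)) + inner ℂ (A (u s)) (u s)) =
        2 * (inner ℂ (u s) (A (u s))).re := by
      have := inner_re_symm (𝕜 := ℂ) (u s) (A (u s))
      simp only [Complex.reCLM_apply, Complex.add_re, RCLike.re_to_complex] at *
      linarith
    rw [hval] at h
    exact h.congr_of_eventuallyEq (.of_forall fun r ↦ norm_sq_eq_re_inner (𝕜 := ℂ) (u r))
  have hg (s : ℝ) : HasDerivAt (fun s ↦ ‖u s‖ ^ 2 * Real.exp (-(2 * c) * s))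
      (2 * (inner ℂ (u s) (A (u s))).re * Real.exp (-(2 * c) * s) +
        ‖u s‖ ^ 2 * (Real.exp (-(2 * c) * s) * (-(2 * c) * 1))) s :=
    (hn s).mul (((hasDerivAt_id s).const_mul (-(2 * c))).exp)
  have hanti : Antitone (fun s ↦ ‖u s‖ ^ 2 * Real.exp (-(2 * c) * s)) := by
    refine antitone_of_deriv_nonpos (fun s ↦ (hg s).differentiableAt) fun s ↦ ?_
    rw [(hg s).deriv]
    nlinarith [hA (u s), Real.exp_pos (-(2 * c) * s)]
  have h01 : ‖NormedSpace.exp A x‖ ^ 2 * Real.exp (-(2 * c)) ≤ ‖x‖ ^ 2 := by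
    simpa [hu_def] using hanti zero_le_one
  refine le_of_sq_le_sq ?_ (by positivity)
  calc ‖NormedSpace.exp A x‖ ^ 2
      = ‖NormedSpace.exp A x‖ ^ 2 * Real.exp (-(2 * c)) * Real.exp (2 * c) := by
        rw [mul_assoc, ← Real.exp_add]; simp
    _ ≤ ‖x‖ ^ 2 * Real.exp (2 * c) := by gcongr
    _ = (Real.exp c * ‖x‖) ^ 2 := by rw [two_mul, Real.exp_add]; ring

/-- If F = F₁ + iF₂ with F₁, F₂ bounded self-adjoint operators on a
complex Hilbert space, then ‖exp(itF)‖ ≤ e^{|t| ‖F₂‖} for every t ∈ ℝ. -/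
theorem exp_itF_norm_bound {H : Type*} [NormedAddCommGroup H]
    [InnerProductSpace ℂ H] [CompleteSpace H]
    (F₁ F₂ : H →L[ℂ] H) (h₁ : IsSelfAdjoint F₁) (h₂ : IsSelfAdjoint F₂)
    (t : ℝ) :
    ‖NormedSpace.exp ((Complex.I * (t : ℂ)) • (F₁ + Complex.I • F₂))‖ ≤
      Real.exp (|t| * ‖F₂‖) := by
  refine norm_exp_le_of_re_inner_le _ _ fun x ↦ ?_
  have him : (inner ℂ x (F₁ x)).im = 0 := h₁.isSymmetric.im_inner_self_apply x
  have hre : |(inner ℂ x (F₂ x)).re| ≤ ‖F₂‖ * ‖x‖ ^ 2 :=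
    calc |(inner ℂ x (F₂ x)).re| ≤ ‖x‖ * ‖F₂ x‖ :=
          (Complex.abs_re_le_norm _).trans (norm_inner_le_norm _ _)
      _ ≤ ‖x‖ * (‖F₂‖ * ‖x‖) := by gcongr; exact F₂.le_opNorm x
      _ = ‖F₂‖ * ‖x‖ ^ 2 := by ring
  have heq : (inner ℂ x (((Complex.I * (t : ℂ)) • (F₁ + Complex.I • F₂)) x)).re =
      -t * (inner ℂ x (F₂ x)).re := by
    simp [him]
  rw [heq]
  calc -t * (inner ℂ x (F₂ x)).re ≤ |-t * (inner ℂ x (F₂ x)).re| := le_abs_self _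
    _ = |t| * |(inner ℂ x (F₂ x)).re| := by rw [abs_mul, abs_neg]
    _ ≤ |t| * (‖F₂‖ * ‖x‖ ^ 2) := by gcongr
    _ = |t| * ‖F₂‖ * ‖x‖ ^ 2 := by ring
end
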